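/- If there exists a regular Hausdorff P-space X with cardinality at least ℵ₂ and weight at most ℵ₁, then there exists a weak Kurepa tree, i.e. a partial order T of cardinality ℵ₁ in which the set of strict predecessors of every element is well-ordered by the order, and which has at least ℵ₂ many uncountable branches (maximal chains of uncountable cardinality). -/

import Mathlib

open Cardinal Set TopologicalSpace

/-- A P-space: the intersection of every countable family of open sets is open. -/
def IsPSpace (X : Type*) [TopologicalSpace X] : Prop :=
  ∀ S : Set (Set X), S.Countable → (∀ s ∈ S, IsOpen s) → IsOpen (⋂₀ S)

/-- Whyburn: for every non-closed `A` and every `x ∈ closure A \ A` there is an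
almost closed `F ⊆ A` converging to `x`. -/
def IsWhyburn (X : Type*) [TopologicalSpace X] : Prop :=
  ∀ A : Set X, ¬ IsClosed A → ∀ x ∈ closure A \ A, ∃ F ⊆ A, closure F \ F = {x}

/-- Weakly Whyburn: for every non-closed `A` there are `x ∈ closure A \ A` and an
almost closed `F ⊆ A` converging to `x`. -/
def IsWeaklyWhyburn (X : Type*) [TopologicalSpace X] : Prop :=
  ∀ A : Set X, ¬ IsClosed A → ∃ x ∈ closure A \ A, ∃ F ⊆ A, closure F \ F = {x}
/-- A weak Kurepa tree: a partial order of cardinality ℵ₁ in which the set of strict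
predecessors of every element is well-ordered by the order, having at least ℵ₂ many
uncountable branches (maximal chains of uncountable cardinality). -/
def IsWeakKurepaTree (T : Type*) [PartialOrder T] : Prop :=
  Cardinal.mk T = Cardinal.aleph 1 ∧
  (∀ t : T, IsWellOrder {s : T // s < t} (fun a b => (a : T) < (b : T))) ∧
  Cardinal.aleph 2 ≤ Cardinal.mk {c : Set T // IsMaxChain (· ≤ ·) c ∧ ¬ c.Countable}

/-- In a regular P-space every point has a neighbourhood base of clopen sets. -/
theorem IsPSpace.exists_isClopen_subset {X : Type*} [TopologicalSpace X] [RegularSpace X]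
    (hX : IsPSpace X) {x : X} {U : Set X} (hU : IsOpen U) (hx : x ∈ U) :
    ∃ C, IsClopen C ∧ x ∈ C ∧ C ⊆ U := by
  have step : ∀ V : {V : Set X // IsOpen V ∧ x ∈ V},
      ∃ W : {V : Set X // IsOpen V ∧ x ∈ V}, closure W.1 ⊆ V.1 := by
    rintro ⟨V, hV, hxV⟩
    obtain ⟨K, hK, hKc, hKV⟩ := exists_mem_nhds_isClosed_subset (hV.mem_nhds hxV)
    exact ⟨⟨interior K, isOpen_interior, mem_interior_iff_mem_nhds.2 hK⟩,
      (closure_minimal interior_subset hKc).trans hKV⟩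
  choose next hnext using step
  let V : ℕ → {V : Set X // IsOpen V ∧ x ∈ V} := fun n => next^[n] ⟨U, hU, hx⟩
  have hV : ∀ n, closure (V (n + 1)).1 ⊆ (V n).1 := fun n => by
    simp only [V, Function.iterate_succ_apply']
    exact hnext _
  refine ⟨⋂ n, (V n).1, ⟨?_, ?_⟩, mem_iInter.2 fun n => (V n).2.2, iInter_subset _ 0⟩
  · have : ⋂ n, (V n).1 = ⋂ n, closure (V n).1 :=
      Subset.antisymm (iInter_mono fun n => subset_closure)
        (subset_iInter fun n => (iInter_subset _ (n + 1)).trans (hV n))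
    rw [this]
    exact isClosed_iInter fun n => isClosed_closure
  · rw [← sInter_range]
    refine hX _ (countable_range _) ?_
    rintro _ ⟨n, rfl⟩
    exact (V n).2.1

/-- A regular Hausdorff P-space of weight at most `#I` has a point-separating family of clopen
sets indexed by `I`. -/
theorem IsPSpace.exists_separating_isClopen {X : Type} [TopologicalSpace X] [T2Space X]
    [RegularSpace X] (hX : IsPSpace X) {B : Set (Set X)} (hB : IsTopologicalBasis B)
    {I : Type} (hI : ℵ₀ ≤ #I) (hBI : #B ≤ #I) :
    ∃ C : I → Set X, (∀ i, IsClopen (C i)) ∧ ∀ x y, (∀ i, x ∈ C i ↔ y ∈ C i) → x = y := by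
  classical
  have hle : #(B × B) ≤ #I := by
    rw [mk_prod]
    simp only [lift_id]
    exact (mul_le_mul' hBI hBI).trans (mul_eq_self hI).le
  obtain ⟨e⟩ := hle
  let D : B × B → Set X := fun p =>
    if h : ∃ C, IsClopen C ∧ p.1.1 ⊆ C ∧ C ⊆ p.2.1 then h.choose else ∅
  have hD : ∀ p, IsClopen (D p) := fun p => by
    by_cases h : ∃ C, IsClopen C ∧ p.1.1 ⊆ C ∧ C ⊆ p.2.1
    · simp only [D, dif_pos h]
      exact h.choose_spec.1
    · simp only [D, dif_neg h]
      exact isClopen_empty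
  refine ⟨fun i => if h : ∃ p, e p = i then D h.choose else ∅, fun i => ?_, fun x y hxy => ?_⟩
  · dsimp only
    split_ifs
    exacts [hD _, isClopen_empty]
  · by_contra hne
    obtain ⟨V, hVB, hxV, hVy⟩ := hB.exists_subset_of_mem_open (a := x) (u := {y}ᶜ) hne
      isOpen_compl_singleton
    obtain ⟨C, hC, hxC, hCV⟩ := hX.exists_isClopen_subset (hB.isOpen hVB) hxV
    obtain ⟨U, hUB, hxU, hUC⟩ := hB.exists_subset_of_mem_open hxC hC.isOpen
    have hex : ∃ C, IsClopen C ∧ U ⊆ C ∧ C ⊆ V := ⟨C, hC, hUC, hCV⟩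
    have hi := hxy (e (⟨U, hUB⟩, ⟨V, hVB⟩))
    have hp : ∃ p, e p = e (⟨U, hUB⟩, ⟨V, hVB⟩) := ⟨_, rfl⟩
    have hpe : hp.choose = (⟨U, hUB⟩, ⟨V, hVB⟩) := e.injective hp.choose_spec
    beta_reduce at hi
    rw [dif_pos hp, hpe] at hi
    simp only [D, dif_pos hex] at hi
    exact hVy (hex.choose_spec.2.2 (hi.1 (hex.choose_spec.2.1 hxU))) rfl

/-- The nodes of the tree of initial segments of the characteristic functions
`i ↦ (x ∈ C i)`: a level together with the trace of a point up to that level. -/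
@[ext]
structure TraceNode {I X : Type} [LinearOrder I] (C : I → Set X) where
  level : I
  trace : Set I
  exists_trace : ∃ x, trace = {i | i ≤ level ∧ x ∈ C i}

namespace TraceNode

variable {I X : Type} [LinearOrder I] {C : I → Set X}

instance : PartialOrder (TraceNode C) where
  le a b := a.level ≤ b.level ∧ a.trace = b.trace ∩ Iic a.level
  le_refl a := by
    obtain ⟨x, hx⟩ := a.exists_trace
    refine ⟨le_rfl, (inter_eq_left.2 ?_).symm⟩
    rw [hx]
    exact fun i hi => hi.1
  le_trans a b c hab hbc := by
    refine ⟨hab.1.trans hbc.1, ?_⟩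
    rw [hab.2, hbc.2, inter_assoc, Iic_inter_Iic, min_eq_right hab.1]
  le_antisymm a b hab hba := by
    have hl := le_antisymm hab.1 hba.1
    obtain ⟨x, hx⟩ := b.exists_trace
    refine TraceNode.ext hl (hab.2.trans (inter_eq_left.2 ?_))
    rw [hx, hl]
    exact fun i hi => hi.1

theorem le_def {a b : TraceNode C} :
    a ≤ b ↔ a.level ≤ b.level ∧ a.trace = b.trace ∩ Iic a.level := Iff.rfl

theorem eq_of_le_of_level_eq {a b : TraceNode C} (hab : a ≤ b) (h : a.level = b.level) :
    a = b := by
  refine le_antisymm hab ⟨h.ge, ?_⟩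
  rw [hab.2, inter_assoc, h, inter_self, ← h]
  have := (le_refl b).2
  rwa [← h] at this

theorem level_lt_of_lt {a b : TraceNode C} (hab : a < b) : a.level < b.level :=
  lt_of_le_of_ne hab.le.1 fun h => hab.ne (eq_of_le_of_level_eq hab.le h)

theorem le_of_le_of_level_le {a b t : TraceNode C} (ha : a ≤ t) (hb : b ≤ t)
    (h : a.level ≤ b.level) : a ≤ b := by
  refine ⟨h, ?_⟩
  rw [ha.2, hb.2, inter_assoc, Iic_inter_Iic, min_eq_right h]

theorem isWellOrder_predecessors [WellFoundedLT I] (t : TraceNode C) :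
    IsWellOrder {s : TraceNode C // s < t} (fun a b => (a : TraceNode C) < b) := by
  let f : (fun a b : {s : TraceNode C // s < t} => (a : TraceNode C) < b) ↪r
      ((· < ·) : I → I → Prop) :=
    { toFun := fun a => a.1.level
      inj' := fun a b h => Subtype.ext
        (eq_of_le_of_level_eq (le_of_le_of_level_le a.2.le b.2.le (le_of_eq h)) h)
      map_rel_iff' := fun {a b} => ⟨fun h => lt_of_le_of_ne
        (le_of_le_of_level_le a.2.le b.2.le (le_of_lt h)) fun hab => h.ne (congrArg level hab),
        level_lt_of_lt⟩ }
  exact f.isWellOrder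

/-- The node at level `i` on the branch of `x`. -/
def ofPoint (C : I → Set X) (x : X) (i : I) : TraceNode C where
  level := i
  trace := {j | j ≤ i ∧ x ∈ C j}
  exists_trace := ⟨x, rfl⟩

theorem ofPoint_mono (x : X) : Monotone (ofPoint C x) := fun i j hij => by
  refine ⟨hij, ?_⟩
  ext k
  simp only [ofPoint, mem_ofPred_eq, mem_inter_iff, mem_Iic]
  exact ⟨fun h => ⟨⟨h.1.trans hij, h.2⟩, h.1⟩, fun h => ⟨h.2, h.1.2⟩⟩

theorem ofPoint_injective (x : X) : Function.Injective (ofPoint C x) :=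
  fun _ _ h => congrArg TraceNode.level h

theorem isMaxChain_range_ofPoint (x : X) : IsMaxChain (· ≤ ·) (range (ofPoint C x)) := by
  refine ⟨?_, fun c hc hsub => hsub.antisymm fun t ht => ⟨t.level, ?_⟩⟩
  · rintro _ ⟨i, rfl⟩ _ ⟨j, rfl⟩ -
    exact (le_total i j).imp (fun h => ofPoint_mono x h) (fun h => ofPoint_mono x h)
  · rcases hc.total (hsub ⟨t.level, rfl⟩) ht with h | h
    · exact eq_of_le_of_level_eq h rfl
    · exact (eq_of_le_of_level_eq h rfl).symm

theorem range_ofPoint_injective (hC : ∀ x y, (∀ i, x ∈ C i ↔ y ∈ C i) → x = y) :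
    Function.Injective fun x => range (ofPoint C x) := fun x y hxy => by
  refine hC x y fun i => ?_
  obtain ⟨j, hj⟩ : ofPoint C x i ∈ range (ofPoint C y) :=
    (show range (ofPoint C x) = range (ofPoint C y) from hxy) ▸ mem_range_self i
  obtain rfl : j = i := congrArg TraceNode.level hj
  have : j ∈ (ofPoint C y j).trace ↔ j ∈ (ofPoint C x j).trace := by rw [hj]
  simpa [ofPoint] using this.symm

/-- The set of points whose trace up to a countable level is prescribed is open. -/
theorem isOpen_setOf_trace_eq [TopologicalSpace X] (hX : IsPSpace X)
    (hC : ∀ i, IsClopen (C i)) (t : TraceNode C) (ht : (Iic t.level).Countable) :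
    IsOpen {x | t.trace = {i | i ≤ t.level ∧ x ∈ C i}} := by
  obtain ⟨y, hy⟩ := t.exists_trace
  have : {x | t.trace = {i | i ≤ t.level ∧ x ∈ C i}} =
      ⋂₀ ((fun i => {x | x ∈ C i ↔ y ∈ C i}) '' Iic t.level) := by
    ext x
    simp only [hy, mem_ofPred_eq, sInter_image, mem_iInter, Set.ext_iff, mem_Iic]
    exact forall_congr' fun i => by tauto
  rw [this]
  refine hX _ (ht.image _) ?_
  rintro _ ⟨i, -, rfl⟩
  by_cases h : y ∈ C i
  · simpa [h] using (hC i).isOpen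
  · simp only [h, iff_false]
    exact (hC i).compl.isOpen

theorem mk_le_mk_prod [TopologicalSpace X] (hX : IsPSpace X) (hC : ∀ i, IsClopen (C i))
    (hI : ∀ i : I, (Iic i).Countable) {B : Set (Set X)} (hB : IsTopologicalBasis B) :
    #(TraceNode C) ≤ #(I × B) := by
  have hex : ∀ t : TraceNode C, ∃ b : B, b.1.Nonempty ∧
      b.1 ⊆ {x | t.trace = {i | i ≤ t.level ∧ x ∈ C i}} := fun t => by
    obtain ⟨x, hx⟩ := t.exists_trace
    obtain ⟨b, hb, hxb, hbt⟩ := hB.exists_subset_of_mem_open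
      (show x ∈ {x | t.trace = {i | i ≤ t.level ∧ x ∈ C i}} from hx)
      (isOpen_setOf_trace_eq hX hC t (hI _))
    exact ⟨⟨b, hb⟩, ⟨x, hxb⟩, hbt⟩
  choose b hne hsub using hex
  refine mk_le_of_injective (f := fun t => (t.level, b t)) fun s t h => ?_
  obtain ⟨hl, hb⟩ := Prod.mk.inj h
  obtain ⟨x, hx⟩ := hne s
  refine TraceNode.ext hl ?_
  rw [show s.trace = _ from hsub s hx, show t.trace = _ from hsub t (hb ▸ hx), hl]

end TraceNode

/-- If there exists a regular Hausdorff P-space of cardinality at least ℵ₂ and weight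
at most ℵ₁, then there exists a weak Kurepa tree. -/
theorem statement7
    (h : ∃ (X : Type) (_ : TopologicalSpace X),
      T2Space X ∧ RegularSpace X ∧ IsPSpace X ∧
      Cardinal.aleph 2 ≤ Cardinal.mk X ∧
      (∃ B : Set (Set X), IsTopologicalBasis B ∧ Cardinal.mk B ≤ Cardinal.aleph 1)) :
    ∃ (T : Type) (_ : PartialOrder T), IsWeakKurepaTree T := by
  obtain ⟨X, _, _, _, hX, hcard, B, hB, hBle⟩ := h
  obtain ⟨I, hI⟩ : ∃ I : Type, #I = ℵ₁ := ⟨_, mk_out _⟩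
  obtain ⟨_, _, hord⟩ := exists_ord_eq_type_lt I
  have hctbl : ∀ i : I, (Iic i).Countable := fun i => by
    rw [← Iio_insert]
    refine Countable.insert _ ?_
    rw [← le_aleph0_iff_set_countable, ← lt_aleph_one_iff, ← hI]
    exact mk_Iio_lt i hord
  have hinf : ℵ₀ ≤ #I := hI ▸ aleph0_le_aleph 1
  obtain ⟨C, hC, hsep⟩ := hX.exists_separating_isClopen hB hinf (hI ▸ hBle)
  obtain ⟨x⟩ : Nonempty X := mk_ne_zero_iff.1 fun h0 =>
    (aleph_pos 2).not_ge (h0 ▸ hcard)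
  refine ⟨TraceNode C, inferInstance, le_antisymm ?_ ?_,
    TraceNode.isWellOrder_predecessors, hcard.trans ?_⟩
  · refine (TraceNode.mk_le_mk_prod hX hC hctbl hB).trans ?_
    simp only [mk_prod, lift_id, hI]
    exact (mul_le_mul' le_rfl hBle).trans (mul_eq_self (aleph0_le_aleph 1)).le
  · exact hI ▸ mk_le_of_injective (TraceNode.ofPoint_injective x)
  · refine mk_le_of_injective (f := fun x => ⟨range (TraceNode.ofPoint C x),
      TraceNode.isMaxChain_range_ofPoint x, fun hc => ?_⟩) fun x y hxy =>
      TraceNode.range_ofPoint_injective hsep (congrArg Subtype.val hxy)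
    rw [← le_aleph0_iff_set_countable, ← lt_aleph_one_iff,
      mk_range_eq _ (TraceNode.ofPoint_injective x), hI] at hc
    exact hc.false
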